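/- Let K be an algebraically closed field of characteristic 0 and let k ≥ 1. Let t : ℕ → ℕ be given by t(0)=1, t(1)=2, t(2)=3, t(3)=2, t(j)=1 for 4 ≤ j ≤ 4+k, and t(j)=0 for j > 4+k. Then there exist finitely many homogeneous ideals J_1, …, J_m of K[x,y] such that every homogeneous ideal I of K[x,y] with t_I = t satisfies φ(I) = J_i for some linear change of variables φ and some i. -/

import Mathlib

open MvPolynomial

noncomputable section

/-- The polynomial ring `K[x,y]`. -/
abbrev Pxy (K : Type*) [Field K] := MvPolynomial (Fin 2) K

/-- An ideal of `K[x,y]` is homogeneous if it contains all homogeneous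
components of each of its elements. -/
def IsHomog {K : Type*} [Field K] (I : Ideal (Pxy K)) : Prop :=
  ∀ f ∈ I, ∀ k : ℕ, homogeneousComponent k f ∈ I

/-- The Hilbert function of an ideal:
`t_I(k) = dim_K (K[x,y]_k / (I ∩ K[x,y]_k))`. -/
def hilb (K : Type*) [Field K] (I : Ideal (Pxy K)) (k : ℕ) : ℕ :=
  Module.finrank K
    (homogeneousSubmodule (Fin 2) K k ⧸
      Submodule.comap (homogeneousSubmodule (Fin 2) K k).subtype (I.restrictScalars K))

/-- A linear change of variables: a `K`-algebra automorphism sending the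
variables to homogeneous polynomials of degree 1. -/
def IsLinChange {K : Type*} [Field K] (φ : Pxy K ≃ₐ[K] Pxy K) : Prop :=
  ∀ i : Fin 2, (φ (X i)).IsHomogeneous 1

/-- `t` is of homogeneous finite type: there are finitely many homogeneous ideals
`J₁, …, Jₘ` such that every homogeneous ideal `I` with Hilbert function `t` is
mapped onto some `Jᵢ` by a linear change of variables. -/
def HomogFiniteType (K : Type*) [Field K] (t : ℕ → ℕ) : Prop :=
  ∃ S : Set (Ideal (Pxy K)), S.Finite ∧ (∀ J ∈ S, IsHomog J) ∧
    ∀ I : Ideal (Pxy K), IsHomog I → (∀ k, hilb K I k = t k) →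
      ∃ φ : Pxy K ≃ₐ[K] Pxy K, IsLinChange φ ∧ Ideal.map φ I ∈ S

section LinChange

variable {K : Type*} [Field K]

theorem IsLinChange.isHomogeneous_map {φ : Pxy K ≃ₐ[K] Pxy K} (hφ : IsLinChange φ)
    {f : Pxy K} {n : ℕ} (hf : f.IsHomogeneous n) : (φ f).IsHomogeneous n := by
  have h : φ f = aeval (fun i => φ (X i)) f := by
    rw [← AlgEquiv.coe_toAlgHom φ]
    exact DFunLike.congr_fun (aeval_unique (φ : Pxy K →ₐ[K] Pxy K)) f
  rw [h]
  simpa using hf.aeval (fun i => φ (X i)) hφ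

theorem IsLinChange.map_homogeneousComponent {φ : Pxy K ≃ₐ[K] Pxy K} (hφ : IsLinChange φ)
    (n : ℕ) (f : Pxy K) :
    φ (homogeneousComponent n f) = homogeneousComponent n (φ f) := by
  have hcomp (i : ℕ) : homogeneousComponent n (φ (homogeneousComponent i f)) =
      if n = i then φ (homogeneousComponent i f) else 0 :=
    homogeneousComponent_of_mem
      (hφ.isHomogeneous_map (homogeneousComponent_isHomogeneous i f))
  conv_rhs => rw [← sum_homogeneousComponent f]
  simp only [map_sum, hcomp]
  rw [Finset.sum_ite_eq]
  split_ifs with h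
  · rfl
  · rw [homogeneousComponent_eq_zero, map_zero]
    rw [Finset.mem_range] at h
    omega

theorem IsLinChange.symm {φ : Pxy K ≃ₐ[K] Pxy K} (hφ : IsLinChange φ) :
    IsLinChange φ.symm := by
  intro i
  have h : φ.symm (X i) = homogeneousComponent 1 (φ.symm (X i)) := by
    apply φ.injective
    rw [hφ.map_homogeneousComponent, AlgEquiv.apply_symm_apply,
      homogeneousComponent_eq_self (isHomogeneous_X K i)]
  rw [h]
  exact homogeneousComponent_isHomogeneous 1 _

theorem IsLinChange.trans {φ ψ : Pxy K ≃ₐ[K] Pxy K} (hφ : IsLinChange φ)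
    (hψ : IsLinChange ψ) : IsLinChange (φ.trans ψ) :=
  fun i => hψ.isHomogeneous_map (hφ i)

theorem exists_isLinChange (a b c d : K) (h : a * d - b * c ≠ 0) :
    ∃ φ : Pxy K ≃ₐ[K] Pxy K, IsLinChange φ ∧
      φ (X 0) = C a * X 0 + C b * X 1 ∧ φ (X 1) = C c * X 0 + C d * X 1 := by
  set e := (a * d - b * c)⁻¹ with he
  have he1 : C e * (C a * C d - C b * C c) = (1 : Pxy K) := by
    rw [← C_mul, ← C_mul, ← C_sub, ← C_mul, he, inv_mul_cancel₀ h, C_1]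
  let F : Pxy K →ₐ[K] Pxy K := aeval ![C a * X 0 + C b * X 1, C c * X 0 + C d * X 1]
  let G : Pxy K →ₐ[K] Pxy K :=
    aeval ![C e * (C d * X 0 - C b * X 1), C e * (C a * X 1 - C c * X 0)]
  have hC : ∀ (H : Pxy K →ₐ[K] Pxy K) (r : K), H (C r) = C r := fun H r => H.commutes r
  refine ⟨AlgEquiv.ofAlgHom F G ?_ ?_, ?_, ?_, ?_⟩
  · ext1 i
    fin_cases i
    · simp [G, hC]
      simp [F]
      linear_combination X 0 * he1
    · simp [G, hC]
      simp [F]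
      linear_combination X 1 * he1
  · ext1 i
    fin_cases i
    · simp [F, hC]
      simp [G]
      linear_combination X 0 * he1
    · simp [F, hC]
      simp [G]
      linear_combination X 1 * he1
  · intro i
    fin_cases i
    · simpa [F] using (isHomogeneous_C_mul_X a 0).add (isHomogeneous_C_mul_X b 1)
    · simpa [F] using (isHomogeneous_C_mul_X c 0).add (isHomogeneous_C_mul_X d 1)
  · simp [F]
  · simp [F]

end LinChange

section Forms

variable {K : Type*} [Field K]

theorem MvPolynomial.IsHomogeneous.exists_eq_X_mul_add {n : ℕ} {f : Pxy K}
    (hf : f.IsHomogeneous (n + 1)) :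
    ∃ g : Pxy K, g.IsHomogeneous n ∧ ∃ c : K, f = X 0 * g + C c * X 1 ^ (n + 1) := by
  classical
  have key : ∀ s : Finset (Fin 2 →₀ ℕ), (∀ d ∈ s, d.degree = n + 1) →
      ∃ g : Pxy K, g.IsHomogeneous n ∧ ∃ c : K,
        ∑ d ∈ s, monomial d (f.coeff d) = X 0 * g + C c * X 1 ^ (n + 1) := by
    intro s
    induction s using Finset.induction_on with
    | empty => exact fun _ => ⟨0, isHomogeneous_zero _ _ _, 0, by simp⟩
    | insert d s hd ih =>
      intro h
      obtain ⟨g, hg, c, hgc⟩ := ih fun e he => h e (Finset.mem_insert_of_mem he)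
      have hdeg := h d (Finset.mem_insert_self _ _)
      rw [Finsupp.degree_eq_sum, Fin.sum_univ_two] at hdeg
      rw [Finset.sum_insert hd, hgc]
      have hm : monomial d (f.coeff d) = C (f.coeff d) * (X 0 ^ d 0 * X 1 ^ d 1 : Pxy K) := by
        rw [monomial_eq, Finsupp.prod_fintype _ _ (by simp), Fin.prod_univ_two]
      rw [hm]
      rcases Nat.eq_zero_or_pos (d 0) with h0 | h0
      · refine ⟨g, hg, f.coeff d + c, ?_⟩
        have h1 : d 1 = n + 1 := by omega
        rw [h0, h1, C_add]
        ring
      · obtain ⟨j, hj⟩ : ∃ j, d 0 = j + 1 := ⟨d 0 - 1, by omega⟩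
        refine ⟨C (f.coeff d) * (X 0 ^ j * X 1 ^ d 1) + g, ?_, c, ?_⟩
        · refine IsHomogeneous.add (IsHomogeneous.C_mul ?_ _) hg
          have := (isHomogeneous_X_pow (R := K) (0 : Fin 2) j).mul
            (isHomogeneous_X_pow (R := K) (1 : Fin 2) (d 1))
          rwa [show j + d 1 = n by omega] at this
        · rw [hj]
          ring
  have h := key f.support fun d hd => by
    by_contra hne
    exact mem_support_iff.1 hd (hf.coeff_eq_zero hne)
  rwa [← f.as_sum] at h

theorem X_zero_not_dvd_C_mul_X_one_pow {c : K} (hc : c ≠ 0) (n : ℕ) :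
    ¬ (X 0 : Pxy K) ∣ C c * X 1 ^ n := by
  rintro ⟨g, hg⟩
  have h := congrArg (eval ![0, 1]) hg
  simp [hc] at h

/-- Multiplying by `x` and adding a multiple of `y ^ (n + 1)`. -/
def formStep (K : Type*) [Field K] (n : ℕ) :
    (homogeneousSubmodule (Fin 2) K n × K) →ₗ[K] homogeneousSubmodule (Fin 2) K (n + 1) :=
  LinearMap.codRestrict _
    ((LinearMap.mulLeft K (X 0 : Pxy K) ∘ₗ
      (homogeneousSubmodule (Fin 2) K n).subtype).coprod
        (LinearMap.toSpanSingleton K (Pxy K) (X 1 ^ (n + 1)))) fun p => by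
    have h1 := (isHomogeneous_X K (0 : Fin 2)).mul p.1.2
    have h2 := (isHomogeneous_X_pow (R := K) (1 : Fin 2) (n + 1)).C_mul p.2
    rw [add_comm 1 n] at h1
    simpa [smul_eq_C_mul] using h1.add h2

theorem formStep_apply (n : ℕ) (p : homogeneousSubmodule (Fin 2) K n × K) :
    (formStep K n p : Pxy K) = X 0 * (p.1 : Pxy K) + C p.2 * X 1 ^ (n + 1) := by
  simp [formStep, smul_eq_C_mul]

theorem formStep_bijective (n : ℕ) : Function.Bijective (formStep K n) := by
  constructor
  · rw [← LinearMap.ker_eq_bot, LinearMap.ker_eq_bot']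
    rintro ⟨g, c⟩ h
    have h' := congrArg Subtype.val h
    rw [formStep_apply] at h'
    have hc : c = 0 := by
      by_contra hc
      refine X_zero_not_dvd_C_mul_X_one_pow hc (n + 1) ⟨-g, ?_⟩
      simp only [ZeroMemClass.coe_zero] at h'
      linear_combination h'
    subst hc
    simpa using h'
  · rintro ⟨f, hf⟩
    obtain ⟨g, hg, c, rfl⟩ := IsHomogeneous.exists_eq_X_mul_add hf
    exact ⟨(⟨g, hg⟩, c), Subtype.ext (formStep_apply _ _)⟩

instance finite_homogeneousSubmodule (n : ℕ) :
    Module.Finite K (homogeneousSubmodule (Fin 2) K n) :=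
  Module.Finite.of_fg (homogeneousSubmodule_fg _ _ n)

theorem finrank_homogeneousSubmodule (n : ℕ) :
    Module.finrank K (homogeneousSubmodule (Fin 2) K n) = n + 1 := by
  induction n with
  | zero =>
    rw [homogeneousSubmodule_zero, Submodule.one_eq_span]
    exact finrank_span_singleton one_ne_zero
  | succ n ih =>
    rw [← (LinearEquiv.ofBijective _ (formStep_bijective (K := K) n)).finrank_eq,
      Module.finrank_prod, ih, Module.finrank_self]

theorem MvPolynomial.IsHomogeneous.mem_span_of_le {n j : ℕ} (hj : n ≤ j) {f : Pxy K}
    (hf : f.IsHomogeneous j) : f ∈ Ideal.span {r : Pxy K | r.IsHomogeneous n} := by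
  induction j, hj using Nat.le_induction generalizing f with
  | base => exact Ideal.subset_span hf
  | succ j _ ih =>
    obtain ⟨g, hg, c, rfl⟩ := hf.exists_eq_X_mul_add
    refine Ideal.add_mem _ (Ideal.mul_mem_left _ _ (ih hg)) ?_
    rw [pow_succ', mul_left_comm]
    exact Ideal.mul_mem_left _ _ (ih ((isHomogeneous_X_pow _ _).C_mul _))

end Forms

section Hilbert

variable {K : Type*} [Field K] {I : Ideal (Pxy K)} {n : ℕ}

theorem mem_of_hilb_eq_zero (h : hilb K I n = 0) {f : Pxy K} (hf : f.IsHomogeneous n) :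
    f ∈ I := by
  have := Module.finrank_zero_iff.1 h
  rw [Submodule.Quotient.subsingleton_iff] at this
  have hmem : (⟨f, hf⟩ : homogeneousSubmodule (Fin 2) K n) ∈
      Submodule.comap (homogeneousSubmodule (Fin 2) K n).subtype (I.restrictScalars K) :=
    this ▸ Submodule.mem_top
  exact hmem

theorem exists_notMem_of_hilb_ne_zero (h : hilb K I n ≠ 0) :
    ∃ f : Pxy K, f.IsHomogeneous n ∧ f ∉ I := by
  by_contra! hall
  refine h (Module.finrank_zero_iff.2 ?_)
  rw [Submodule.Quotient.subsingleton_iff, eq_top_iff]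
  rintro ⟨f, hf⟩ -
  exact hall f hf

theorem exists_combination_mem_of_hilb_eq_one (h : hilb K I n = 1) {f g : Pxy K}
    (hf : f.IsHomogeneous n) (hg : g.IsHomogeneous n) :
    ∃ a b : K, (a ≠ 0 ∨ b ≠ 0) ∧ C a * f + C b * g ∈ I := by
  obtain ⟨v, hv⟩ := finrank_le_one_iff.1 (le_of_eq h)
  set L := Submodule.comap (homogeneousSubmodule (Fin 2) K n).subtype (I.restrictScalars K)
  obtain ⟨c, hc⟩ := hv (L.mkQ ⟨f, hf⟩)
  obtain ⟨d, hd⟩ := hv (L.mkQ ⟨g, hg⟩)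
  have key : ∀ a b : K, a * c + b * d = 0 → C a * f + C b * g ∈ I := by
    intro a b hab
    have hz : L.mkQ (a • ⟨f, hf⟩ + b • ⟨g, hg⟩) = 0 := by
      rw [map_add, map_smul, map_smul, ← hc, ← hd, smul_smul, smul_smul, ← add_smul, hab,
        zero_smul]
    rw [Submodule.mkQ_apply, Submodule.Quotient.mk_eq_zero] at hz
    simpa [L, smul_eq_C_mul] using hz
  by_cases h0 : c = 0
  · exact ⟨1, 0, Or.inl one_ne_zero, key _ _ (by simp [h0])⟩
  · exact ⟨d, -c, Or.inr (neg_ne_zero.2 h0), key _ _ (by ring)⟩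

theorem finrank_inf_add_hilb (I : Ideal (Pxy K)) (n : ℕ) :
    Module.finrank K ↥(homogeneousSubmodule (Fin 2) K n ⊓ I.restrictScalars K) + hilb K I n =
      n + 1 := by
  rw [← finrank_homogeneousSubmodule (K := K) n, add_comm,
    ← Submodule.finrank_quotient_add_finrank (Submodule.comap
      (homogeneousSubmodule (Fin 2) K n).subtype (I.restrictScalars K)), hilb,
    ← Submodule.map_comap_subtype, Submodule.finrank_map_subtype_eq]

theorem eq_zero_of_hilb_eq (h : hilb K I n = n + 1) {f : Pxy K} (hf : f.IsHomogeneous n)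
    (hfI : f ∈ I) : f = 0 := by
  have h0 := finrank_inf_add_hilb I n
  have h1 : Module.finrank K
      ↥(homogeneousSubmodule (Fin 2) K n ⊓ I.restrictScalars K) = 0 := by omega
  have : Module.Finite K ↥(homogeneousSubmodule (Fin 2) K n ⊓ I.restrictScalars K) :=
    Submodule.finiteDimensional_inf_left _ _
  rw [Submodule.finrank_eq_zero] at h1
  have hmem : f ∈ homogeneousSubmodule (Fin 2) K n ⊓ I.restrictScalars K := ⟨hf, hfI⟩
  rwa [h1, Submodule.mem_bot] at hmem

end Hilbert

section PencilIdeal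

variable {K : Type*} [Field K]

/-- The ideal generated by `ℓ • V`, by `ℓ` times the cubic forms, and by the forms of
degree `n`. -/
def pencilIdeal (l : Pxy K) (V : Submodule K (Pxy K)) (n : ℕ) : Ideal (Pxy K) :=
  Ideal.span ((l * ·) '' (V : Set (Pxy K)) ∪ (l * ·) '' {r | r.IsHomogeneous 3} ∪
    {r | r.IsHomogeneous n})

theorem IsLinChange.image_setOf_isHomogeneous {φ : Pxy K ≃ₐ[K] Pxy K} (hφ : IsLinChange φ)
    (n : ℕ) : φ '' {r | r.IsHomogeneous n} = {r | r.IsHomogeneous n} := by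
  ext f
  constructor
  · rintro ⟨g, hg, rfl⟩
    exact hφ.isHomogeneous_map hg
  · intro hf
    exact ⟨φ.symm f, hφ.symm.isHomogeneous_map hf, φ.apply_symm_apply f⟩

theorem map_pencilIdeal {φ : Pxy K ≃ₐ[K] Pxy K} (hφ : IsLinChange φ) (l : Pxy K)
    (V : Submodule K (Pxy K)) (n : ℕ) :
    Ideal.map φ (pencilIdeal l V n) = pencilIdeal (φ l) (V.map φ.toLinearMap) n := by
  have himg : ∀ s : Set (Pxy K), φ '' ((l * ·) '' s) = (φ l * ·) '' (φ '' s) := by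
    intro s
    simp only [Set.image_image, map_mul]
  rw [pencilIdeal, Ideal.map_span, Set.image_union, Set.image_union, himg, himg,
    hφ.image_setOf_isHomogeneous, hφ.image_setOf_isHomogeneous, pencilIdeal]
  rfl

theorem isHomog_pencilIdeal {l : Pxy K} (hl : l.IsHomogeneous 1) {V : Submodule K (Pxy K)}
    (hV : V ≤ homogeneousSubmodule (Fin 2) K 2) (n : ℕ) : IsHomog (pencilIdeal l V n) := by
  let _ := gradedAlgebra (σ := Fin 2) (R := K)
  have h : (pencilIdeal l V n).IsHomogeneous (homogeneousSubmodule (Fin 2) K) := by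
    refine Ideal.homogeneous_span _ _ ?_
    rintro _ ((⟨v, hv, rfl⟩ | ⟨r, hr, rfl⟩) | hr)
    · exact ⟨_, hl.mul (hV hv)⟩
    · exact ⟨_, hl.mul hr⟩
    · exact ⟨_, hr⟩
  intro f hf j
  exact homogeneousComponent_mem_of_mem h hf j

end PencilIdeal

section Structure

variable {K : Type*} [Field K] {I : Ideal (Pxy K)}

theorem mul_mem_of_mem_span {R : Type*} [CommRing R] {J : Ideal R} {l g : R} {s : Set R}
    (h : ∀ r ∈ s, l * r ∈ J) (hg : g ∈ Ideal.span s) : l * g ∈ J := by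
  have hle : Ideal.span s ≤ Submodule.comap (LinearMap.mulLeft R l) J := Ideal.span_le.2 h
  exact hle hg

theorem mem_of_C_mul_mem {a : K} (ha : a ≠ 0) {f : Pxy K} (h : C a * f ∈ I) : f ∈ I := by
  have := I.mul_mem_left (C a⁻¹) h
  rwa [← mul_assoc, ← C_mul, inv_mul_cancel₀ ha, C_1, one_mul] at this

/-- If two consecutive quotients are one-dimensional, some linear form kills the first. -/
theorem exists_linear_mul_mem {n : ℕ} (h : hilb K I n = 1) (h' : hilb K I (n + 1) = 1) :
    ∃ φ : Pxy K ≃ₐ[K] Pxy K, IsLinChange φ ∧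
      ∀ f : Pxy K, f.IsHomogeneous n → φ (X 0) * f ∈ I := by
  obtain ⟨e, he, heI⟩ := exists_notMem_of_hilb_ne_zero (h.trans_ne one_ne_zero)
  obtain ⟨a, b, hab, hmem⟩ := exists_combination_mem_of_hilb_eq_one h'
    (by simpa [add_comm] using (isHomogeneous_X K (0 : Fin 2)).mul he)
    (by simpa [add_comm] using (isHomogeneous_X K (1 : Fin 2)).mul he)
  obtain ⟨c, d, hcd⟩ : ∃ c d : K, a * d - b * c ≠ 0 := by
    rcases hab with ha | hb
    · exact ⟨0, 1, by simpa using ha⟩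
    · exact ⟨1, 0, by simpa using hb⟩
  obtain ⟨φ, hφ, h0, -⟩ := exists_isLinChange a b c d hcd
  refine ⟨φ, hφ, fun f hf => ?_⟩
  have hle : φ (X 0) * e ∈ I := by
    rw [h0]
    convert hmem using 1
    ring
  obtain ⟨r, s, hrs, hc⟩ := exists_combination_mem_of_hilb_eq_one h hf he
  have hr : r ≠ 0 := by
    rintro rfl
    refine heI (mem_of_C_mul_mem (hrs.resolve_left (by simp)) ?_)
    simpa using hc
  refine mem_of_C_mul_mem hr ?_
  have := I.sub_mem (I.mul_mem_left (φ (X 0)) hc) (I.mul_mem_left (C s) hle)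
  convert this using 1
  ring

theorem prime_map_X_zero {φ : Pxy K ≃ₐ[K] Pxy K} : Prime (φ (X 0)) :=
  (MulEquiv.prime_iff φ.toMulEquiv).2 (X_prime (i := (0 : Fin 2)))

theorem not_map_X_zero_dvd {φ : Pxy K ≃ₐ[K] Pxy K} {c : K} (hc : c ≠ 0) (n : ℕ) :
    ¬ φ (X 0) ∣ C c * φ (X 1) ^ n := by
  have h : C c * φ (X 1) ^ n = φ (C c * X 1 ^ n) := by
    rw [map_mul, map_pow]
    congr 1
    exact (φ.commutes c).symm
  rw [h, map_dvd_iff φ]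
  exact X_zero_not_dvd_C_mul_X_one_pow hc n

theorem IsLinChange.exists_eq_mul_add {φ : Pxy K ≃ₐ[K] Pxy K} (hφ : IsLinChange φ) {n : ℕ}
    {f : Pxy K} (hf : f.IsHomogeneous (n + 1)) :
    ∃ g : Pxy K, g.IsHomogeneous n ∧ ∃ c : K,
      f = φ (X 0) * g + C c * φ (X 1) ^ (n + 1) := by
  obtain ⟨g, hg, c, h⟩ := (hφ.symm.isHomogeneous_map hf).exists_eq_X_mul_add
  refine ⟨φ g, hφ.isHomogeneous_map hg, c, ?_⟩
  have h' := congrArg φ h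
  rw [AlgEquiv.apply_symm_apply, map_add, map_mul, map_mul, map_pow] at h'
  rw [h']
  congr 2
  exact φ.commutes c

theorem IsLinChange.exists_eq_mul_of_dvd {φ : Pxy K ≃ₐ[K] Pxy K} (hφ : IsLinChange φ)
    {n : ℕ} {f : Pxy K} (hf : f.IsHomogeneous (n + 1)) (hdvd : φ (X 0) ∣ f) :
    ∃ g : Pxy K, g.IsHomogeneous n ∧ f = φ (X 0) * g := by
  obtain ⟨g, hg, c, rfl⟩ := hφ.exists_eq_mul_add hf
  have hc : c = 0 := by
    by_contra hc
    exact not_map_X_zero_dvd hc _ ((dvd_add_right (dvd_mul_right _ _)).1 hdvd)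
  exact ⟨g, hg, by simp [hc]⟩

theorem IsLinChange.dvd_of_mem {φ : Pxy K ≃ₐ[K] Pxy K} (hφ : IsLinChange φ) {n : ℕ}
    (hmul : ∀ f : Pxy K, f.IsHomogeneous n → φ (X 0) * f ∈ I) (h : hilb K I (n + 1) ≠ 0)
    {f : Pxy K} (hf : f.IsHomogeneous (n + 1)) (hfI : f ∈ I) : φ (X 0) ∣ f := by
  obtain ⟨g, hg, c, rfl⟩ := hφ.exists_eq_mul_add hf
  have hc : c = 0 := by
    by_contra hc
    have hpow : φ (X 1) ^ (n + 1) ∈ I :=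
      mem_of_C_mul_mem hc ((I.add_mem_iff_right (hmul g hg)).1 hfI)
    obtain ⟨p, hp, hpI⟩ := exists_notMem_of_hilb_ne_zero h
    obtain ⟨q, hq, d, rfl⟩ := hφ.exists_eq_mul_add hp
    exact hpI (I.add_mem (hmul q hq) (I.mul_mem_left _ hpow))
  simp [hc]

theorem IsLinChange.dvd_of_mem_of_succ {φ : Pxy K ≃ₐ[K] Pxy K} (hφ : IsLinChange φ) {n : ℕ}
    (h : ∀ f : Pxy K, f.IsHomogeneous (n + 1) → f ∈ I → φ (X 0) ∣ f)
    {f : Pxy K} (hf : f.IsHomogeneous n) (hfI : f ∈ I) : φ (X 0) ∣ f := by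
  have hdvd := h (φ (X 1) * f) (by simpa [add_comm] using (hφ 1).mul hf)
    (I.mul_mem_left _ hfI)
  refine (prime_map_X_zero.dvd_or_dvd hdvd).resolve_left fun h1 => ?_
  exact not_map_X_zero_dvd (one_ne_zero (α := K)) 1 (by simpa using h1)

theorem exists_eq_pencilIdeal (hI : IsHomog I) {N : ℕ} (hN : 5 ≤ N) (h2 : hilb K I 2 = 3)
    (h3 : hilb K I 3 = 2) (h1 : ∀ j, 4 ≤ j → j ≤ N → hilb K I j = 1)
    (h0 : hilb K I (N + 1) = 0) :
    ∃ φ : Pxy K ≃ₐ[K] Pxy K, IsLinChange φ ∧ ∃ V : Submodule K (Pxy K),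
      V ≤ homogeneousSubmodule (Fin 2) K 2 ∧ Module.finrank K V = 2 ∧
        I = pencilIdeal (φ (X 0)) V (N + 1) := by
  obtain ⟨φ, hφ, hmul4⟩ :=
    exists_linear_mul_mem (h1 4 le_rfl (by omega)) (h1 5 (by omega) hN)
  have hmul : ∀ j, 4 ≤ j → ∀ f : Pxy K, f.IsHomogeneous j → φ (X 0) * f ∈ I :=
    fun j hj f hf => mul_mem_of_mem_span hmul4 (hf.mem_span_of_le hj)
  have hd5 : ∀ j, 4 ≤ j → j + 1 ≤ N → ∀ f : Pxy K, f.IsHomogeneous (j + 1) → f ∈ I →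
      φ (X 0) ∣ f := fun j hj hjN f hf hfI =>
    hφ.dvd_of_mem (hmul j hj) (by rw [h1 _ (by omega) hjN]; exact one_ne_zero) hf hfI
  have hd4 : ∀ f : Pxy K, f.IsHomogeneous 4 → f ∈ I → φ (X 0) ∣ f := fun f hf hfI =>
    hφ.dvd_of_mem_of_succ (hd5 4 le_rfl hN) hf hfI
  have hd3 : ∀ f : Pxy K, f.IsHomogeneous 3 → f ∈ I → φ (X 0) ∣ f := fun f hf hfI =>
    hφ.dvd_of_mem_of_succ hd4 hf hfI
  have hmul3 : ∀ f : Pxy K, f.IsHomogeneous 3 → φ (X 0) * f ∈ I := by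
    intro f hf
    obtain ⟨a, b, hab, hmem⟩ := exists_combination_mem_of_hilb_eq_one
      (h1 4 le_rfl (by omega)) ((hφ 0).mul hf) (by simpa using (hφ 1).pow 4)
    have hhom : (C a * (φ (X 0) * f) + C b * φ (X 1) ^ 4).IsHomogeneous 4 :=
      (((hφ 0).mul hf).C_mul a).add (by simpa using ((hφ 1).pow 4).C_mul b)
    have hb : b = 0 := by
      by_contra hb
      exact not_map_X_zero_dvd hb 4
        ((dvd_add_right ((dvd_mul_right _ _).mul_left _)).1 (hd4 _ hhom hmem))
    subst hb
    exact mem_of_C_mul_mem (hab.resolve_right (by simp)) (by simpa using hmem)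
  let V : Submodule K (Pxy K) := homogeneousSubmodule (Fin 2) K 2 ⊓
    Submodule.comap (LinearMap.mulLeft K (φ (X 0))) (I.restrictScalars K)
  have hVmap : V.map (LinearMap.mulLeft K (φ (X 0))) =
      homogeneousSubmodule (Fin 2) K 3 ⊓ I.restrictScalars K := by
    apply le_antisymm
    · rintro _ ⟨v, ⟨hv, hvI⟩, rfl⟩
      exact ⟨(hφ 0).mul hv, hvI⟩
    · rintro f ⟨hf, hfI⟩
      obtain ⟨g, hg, rfl⟩ := hφ.exists_eq_mul_of_dvd hf (hd3 f hf hfI)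
      exact ⟨g, ⟨hg, hfI⟩, rfl⟩
  have hV : Module.finrank K V = 2 := by
    have hinj : Function.Injective (LinearMap.mulLeft K (φ (X 0))) :=
      mul_right_injective₀ prime_map_X_zero.ne_zero
    have := finrank_inf_add_hilb I 3
    rw [← hVmap, ← (Submodule.equivMapOfInjective _ hinj V).finrank_eq, h3] at this
    omega
  refine ⟨φ, hφ, V, inf_le_left, hV, le_antisymm ?_ ?_⟩
  · intro f hf
    rw [← sum_homogeneousComponent f]
    refine Ideal.sum_mem _ fun j _ => ?_
    have hj := hI f hf j
    have hhom := homogeneousComponent_isHomogeneous j f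
    generalize homogeneousComponent j f = p at hj hhom
    rcases le_or_gt (N + 1) j with hjN | hjN
    · exact Ideal.span_mono (Set.subset_union_right) (hhom.mem_span_of_le hjN)
    rcases le_or_gt 4 j with hj4 | hj4
    · obtain ⟨i, rfl⟩ : ∃ i, j = i + 1 := ⟨j - 1, by omega⟩
      have hdvd : φ (X 0) ∣ p := by
        rcases (show 3 ≤ i by omega).eq_or_lt with rfl | hi
        · exact hd4 p hhom hj
        · exact hd5 i hi (by omega) p hhom hj
      obtain ⟨g, hg, rfl⟩ := hφ.exists_eq_mul_of_dvd hhom hdvd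
      exact mul_mem_of_mem_span
        (fun r hr => Ideal.subset_span (Or.inl (Or.inr ⟨r, hr, rfl⟩)))
        (hg.mem_span_of_le (show 3 ≤ i by omega))
    rcases (show j ≤ 3 by omega).eq_or_lt with rfl | hj3
    · obtain ⟨g, hg, rfl⟩ := hφ.exists_eq_mul_of_dvd hhom (hd3 p hhom hj)
      exact Ideal.subset_span (Or.inl (Or.inl ⟨g, ⟨hg, hj⟩, rfl⟩))
    · have hz : X 0 ^ (2 - j) * p = 0 := by
        refine eq_zero_of_hilb_eq (n := 2) h2 ?_ (I.mul_mem_left _ hj)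
        have := (isHomogeneous_X_pow (R := K) (0 : Fin 2) (2 - j)).mul hhom
        rwa [show 2 - j + j = 2 by omega] at this
      rw [(mul_eq_zero.1 hz).resolve_left (pow_ne_zero _ (X_ne_zero _))]
      exact zero_mem _
  · refine Ideal.span_le.2 ?_
    rintro _ ((⟨v, hv, rfl⟩ | ⟨r, hr, rfl⟩) | hr)
    · exact hv.2
    · exact hmul3 r hr
    · exact mem_of_hilb_eq_zero h0 hr

end Structure

section Pencils

variable {K : Type*} [Field K]

theorem MvPolynomial.IsHomogeneous.exists_eq_quadratic {f : Pxy K} (hf : f.IsHomogeneous 2) :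
    ∃ a b c : K, f = C a * X 0 ^ 2 + C b * (X 0 * X 1) + C c * X 1 ^ 2 := by
  obtain ⟨g, hg, c, rfl⟩ := hf.exists_eq_X_mul_add
  obtain ⟨e, he, b, rfl⟩ := hg.exists_eq_X_mul_add
  obtain ⟨a, rfl⟩ : ∃ a, C a = e :=
    ⟨_, (totalDegree_eq_zero_iff_eq_C.1 ((totalDegree_zero_iff_isHomogeneous _).2 he)).symm⟩
  exact ⟨a, b, c, by ring⟩

theorem quadratic_eq_zero {a b c : K}
    (h : C a * X 0 ^ 2 + C b * (X 0 * X 1) + C c * X 1 ^ 2 = (0 : Pxy K)) :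
    a = 0 ∧ b = 0 ∧ c = 0 := by
  have ha := congrArg (eval ![1, 0]) h
  have hc := congrArg (eval ![0, 1]) h
  have hb := congrArg (eval ![1, 1]) h
  simp at ha hb hc
  simp_all

theorem eq_span_pair {M : Type*} [AddCommGroup M] [Module K M] {V : Submodule K M}
    (hV : Module.finrank K V = 2) {p q : M} (hp : p ∈ V) (hq : q ∈ V)
    (hpq : ∀ s t : K, s • p + t • q = 0 → s = 0 ∧ t = 0) : V = Submodule.span K {p, q} := by
  have : Module.Finite K V := Module.finite_of_finrank_pos (by omega)
  have hli : LinearIndependent K ![p, q] := LinearIndependent.pair_iff.2 hpq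
  have hfin := finrank_span_eq_card hli
  rw [Matrix.range_cons, Matrix.range_cons, Matrix.range_empty, Set.union_empty,
    Set.singleton_union, Fintype.card_fin] at hfin
  refine (Submodule.eq_of_le_of_finrank_eq (Submodule.span_le.2 ?_) (hfin.trans hV.symm)).symm
  rintro _ (rfl | rfl)
  exacts [hp, hq]

/-- Representatives of the pencils of binary quadratic forms under the linear changes of
variables fixing `x`. -/
def normalPencils (K : Type*) [Field K] : Set (Submodule K (Pxy K)) :=
  {Submodule.span K {X 0 ^ 2, X 0 * X 1}, Submodule.span K {X 0 ^ 2, X 1 ^ 2},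
    Submodule.span K {X 0 * X 1, X 1 ^ 2}, Submodule.span K {X 0 * X 1, X 0 ^ 2 + X 1 ^ 2}}

theorem le_of_mem_normalPencils {V : Submodule K (Pxy K)} (hV : V ∈ normalPencils K) :
    V ≤ homogeneousSubmodule (Fin 2) K 2 := by
  have h0 := isHomogeneous_X_pow (R := K) (0 : Fin 2) 2
  have h1 := isHomogeneous_X_pow (R := K) (1 : Fin 2) 2
  have h01 := (isHomogeneous_X K (0 : Fin 2)).mul (isHomogeneous_X K (1 : Fin 2))
  rcases hV with rfl | rfl | rfl | rfl <;> refine Submodule.span_le.2 ?_ <;>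
    rintro _ (rfl | rfl)
  exacts [h0, h01, h0, h1, h01, h1, h01, h0.add h1]

theorem exists_map_mem_normalPencils [IsAlgClosed K] [CharZero K] {V : Submodule K (Pxy K)}
    (hV : V ≤ homogeneousSubmodule (Fin 2) K 2) (hV2 : Module.finrank K V = 2) :
    ∃ φ : Pxy K ≃ₐ[K] Pxy K, IsLinChange φ ∧ φ (X 0) = X 0 ∧
      V.map φ.toLinearMap ∈ normalPencils K := by
  have hfin : Module.Finite K V := Module.finite_of_finrank_pos (by omega)
  have hmap2 (φ : Pxy K ≃ₐ[K] Pxy K) : Module.finrank K (V.map φ.toLinearMap) = 2 :=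
    (LinearEquiv.finrank_map_eq φ.toLinearEquiv V).trans hV2
  have hsub (e d : K) (hd : d ≠ 0) : ∃ φ : Pxy K ≃ₐ[K] Pxy K, IsLinChange φ ∧
      φ (X 0) = X 0 ∧ ∀ a b c : K, C a * X 0 ^ 2 + C b * (X 0 * X 1) + C c * X 1 ^ 2 ∈ V →
        C (a + b * e + c * e ^ 2) * X 0 ^ 2 + C (b * d + 2 * c * e * d) * (X 0 * X 1) +
          C (c * d ^ 2) * X 1 ^ 2 ∈ V.map φ.toLinearMap := by
    obtain ⟨φ, hφ, h0, h1⟩ := exists_isLinChange 1 0 e d (by simpa using hd)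
    have hC (r : K) : φ (C r) = C r := φ.commutes r
    refine ⟨φ, hφ, by simpa using h0, fun a b c h => ⟨_, h, ?_⟩⟩
    have h2 : (C 2 : Pxy K) = 2 := map_ofNat C 2
    simp only [AlgEquiv.toLinearMap_apply, map_add, map_mul, map_pow, hC, h0, h1, h2, map_one,
      map_zero]
    ring
  by_cases hx : ∀ a b c : K, C a * X 0 ^ 2 + C b * (X 0 * X 1) + C c * X 1 ^ 2 ∈ V → c = 0
  · refine ⟨AlgEquiv.refl, isHomogeneous_X K, rfl, Or.inl ?_⟩
    have hle : V ≤ Submodule.span K {X 0 ^ 2, X 0 * X 1} := by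
      intro v hv
      obtain ⟨a, b, c, rfl⟩ := IsHomogeneous.exists_eq_quadratic (hV hv)
      rw [hx a b c hv]
      exact Submodule.mem_span_pair.2 ⟨a, b, by simp [smul_eq_C_mul]⟩
    have : Module.Finite K (Submodule.span K {(X 0 ^ 2 : Pxy K), X 0 * X 1}) :=
      Module.Finite.span_of_finite K (Set.toFinite _)
    have hcard : Module.finrank K (Submodule.span K {(X 0 ^ 2 : Pxy K), X 0 * X 1}) ≤ 2 := by
      classical
      have := finrank_span_finset_le_card (R := K) (M := Pxy K) {X 0 ^ 2, X 0 * X 1}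
      rw [Finset.coe_pair] at this
      exact this.trans Finset.card_le_two
    rw [← Submodule.eq_of_le_of_finrank_le hle (hcard.trans hV2.ge)]
    exact Submodule.map_id V
  push Not at hx
  obtain ⟨a, b, c, hp, hc⟩ := hx
  obtain ⟨α, β, hq, hαβ⟩ : ∃ α β : K, C α * X 0 ^ 2 + C β * (X 0 * X 1) ∈ V ∧
      (α ≠ 0 ∨ β ≠ 0) := by
    obtain ⟨q, hq, hqp⟩ : ∃ q ∈ V, q ∉ Submodule.span K
        {C a * X 0 ^ 2 + C b * (X 0 * X 1) + C c * X 1 ^ 2} := by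
      by_contra! hle
      have h1 := Submodule.finrank_mono (R := K) hle
      have h2 := finrank_span_le_card (R := K)
        {C a * X 0 ^ 2 + C b * (X 0 * X 1) + C c * (X 1 : Pxy K) ^ 2}
      simp only [Set.toFinset_singleton, Finset.card_singleton] at h2
      have h3 := hV2.ge.trans (h1.trans h2)
      omega
    obtain ⟨a', b', c', rfl⟩ := IsHomogeneous.exists_eq_quadratic (hV hq)
    refine ⟨c * a' - c' * a, c * b' - c' * b, ?_, ?_⟩
    · have := V.sub_mem (V.smul_mem c hq) (V.smul_mem c' hp)
      convert this using 1
      simp only [smul_eq_C_mul, C_sub, C_mul]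
      ring
    · by_contra! h
      refine hqp (Submodule.mem_span_singleton.2 ⟨c' / c, ?_⟩)
      have ha' : a' = c' / c * a := by
        field_simp
        linear_combination h.1
      have hb' : b' = c' / c * b := by
        field_simp
        linear_combination h.2
      have hc' : c' = c' / c * c := by field_simp
      rw [ha', hb', smul_eq_C_mul]
      nth_rw 4 [hc']
      simp only [C_mul]
      ring
  have hscale {W : Submodule K (Pxy K)} {r : K} (hr : r ≠ 0) {f : Pxy K}
      (h : C r * f ∈ W) : f ∈ W := by
    rw [← smul_eq_C_mul] at h
    exact (W.smul_mem_iff hr).1 h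
  replace hq : C α * X 0 ^ 2 + C β * (X 0 * X 1) + C 0 * X 1 ^ 2 ∈ V := by simpa using hq
  by_cases hβ : β = 0
  · subst hβ
    have hα : α ≠ 0 := by simpa using hαβ
    obtain ⟨φ, hφ, h0, hφV⟩ := hsub (-b / (2 * c)) 1 one_ne_zero
    have hx2 : X 0 ^ 2 ∈ V.map φ.toLinearMap := hscale hα (by simpa using hφV _ _ _ hq)
    refine ⟨φ, hφ, h0, Or.inr (Or.inl (eq_span_pair (hmap2 φ) hx2 ?_ ?_))⟩
    · have hb : b * 1 + 2 * c * (-b / (2 * c)) * 1 = 0 := by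
        field_simp
        ring
      have hp' := hφV _ _ _ hp
      rw [hb, C_0, zero_mul, add_zero, ← smul_eq_C_mul,
        Submodule.add_mem_iff_right _ (Submodule.smul_mem _ _ hx2)] at hp'
      exact hscale (by simpa using hc) hp'
    · intro s t hst
      have := quadratic_eq_zero (a := s) (b := 0) (c := t) (by simpa [smul_eq_C_mul] using hst)
      exact ⟨this.1, this.2.2⟩
  · set A := a + b * (-α / β) + c * (-α / β) ^ 2 with hA
    obtain ⟨t, ht, htA⟩ : ∃ t : K, t ≠ 0 ∧ (A ≠ 0 → c * (t / β) ^ 2 = A) := by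
      by_cases hA0 : A = 0
      · exact ⟨1, one_ne_zero, fun h => (h hA0).elim⟩
      · obtain ⟨t, ht⟩ := IsAlgClosed.exists_pow_nat_eq (A * β ^ 2 / c) two_pos
        refine ⟨t, ?_, fun _ => ?_⟩
        · rintro rfl
          have : A * β ^ 2 / c ≠ 0 := div_ne_zero (mul_ne_zero hA0 (pow_ne_zero _ hβ)) hc
          simp [← ht] at this
        · rw [div_pow, ht]
          field_simp
    obtain ⟨φ, hφ, h0, hφV⟩ := hsub (-α / β) (t / β) (div_ne_zero ht hβ)
    have hxy : X 0 * X 1 ∈ V.map φ.toLinearMap := by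
      have hα : α + β * (-α / β) + 0 * (-α / β) ^ 2 = 0 := by
        field_simp
        ring
      have hq' := hφV _ _ _ hq
      rw [hα] at hq'
      exact hscale (div_ne_zero ht hβ) (hscale hβ (by simpa [mul_assoc] using hq'))
    have hp' := hφV _ _ _ hp
    rw [← hA, add_right_comm, ← smul_eq_C_mul _ (b * _ + _),
      Submodule.add_mem_iff_left _ (Submodule.smul_mem _ _ hxy)] at hp'
    have hc' : c * (t / β) ^ 2 ≠ 0 := mul_ne_zero hc (pow_ne_zero _ (div_ne_zero ht hβ))
    refine ⟨φ, hφ, h0, Or.inr (Or.inr ?_)⟩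
    by_cases hA0 : A = 0
    · rw [hA0, C_0, zero_mul, zero_add] at hp'
      refine Or.inl (eq_span_pair (hmap2 φ) hxy (hscale hc' hp') fun s r hsr => ?_)
      exact (quadratic_eq_zero (a := 0) (b := s) (c := r)
        (by simpa [smul_eq_C_mul] using hsr)).2
    · rw [htA hA0, ← mul_add] at hp'
      refine Or.inr (eq_span_pair (hmap2 φ) hxy (hscale hA0 hp') fun s r hsr => ?_)
      refine (quadratic_eq_zero (a := r) (b := s) (c := r) ?_).2
      rw [← hsr, smul_eq_C_mul, smul_eq_C_mul]
      ring

end Pencils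

/-- The sequence `T₄ = (1, 2, 3, 2, 1, …, 1)` is of homogeneous finite type. -/
theorem stmt14 (K : Type*) [Field K] [IsAlgClosed K] [CharZero K]
    (k : ℕ) (hk : 1 ≤ k) :
    HomogFiniteType K
      (fun j => if j < 3 then j + 1 else if j = 3 then 2
        else if j ≤ 4 + k then 1 else 0) := by
  refine ⟨(pencilIdeal (X 0) · (4 + k + 1)) '' normalPencils K,
    Set.Finite.image _ (by simp [normalPencils]), ?_, ?_⟩
  · rintro _ ⟨V, hV, rfl⟩
    exact isHomog_pencilIdeal (isHomogeneous_X K 0) (le_of_mem_normalPencils hV) _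
  · intro I hI ht
    obtain ⟨φ, hφ, V, hV, hV2, rfl⟩ := exists_eq_pencilIdeal hI (N := 4 + k) (by omega)
      (by simp [ht]) (by simp [ht])
      (fun j h4 hj => by
        simp only [ht]
        rw [if_neg (by omega), if_neg (by omega), if_pos hj])
      (by simp only [ht]; rw [if_neg (by omega), if_neg (by omega), if_neg (by omega)])
    have hV' : V.map φ.symm.toLinearMap ≤ homogeneousSubmodule (Fin 2) K 2 := by
      rintro _ ⟨v, hv, rfl⟩
      exact hφ.symm.isHomogeneous_map (hV hv)
    obtain ⟨ψ, hψ, h0, hmem⟩ := exists_map_mem_normalPencils hV'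
      ((LinearEquiv.finrank_map_eq φ.symm.toLinearEquiv V).trans hV2)
    refine ⟨φ.symm.trans ψ, hφ.symm.trans hψ, _, hmem, ?_⟩
    rw [map_pencilIdeal (hφ.symm.trans hψ)]
    simp only [AlgEquiv.trans_apply, AlgEquiv.symm_apply_apply, h0]
    rw [← Submodule.map_comp]
    rfl
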